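/- Let f, a : (0,∞) → ℝ be C² solutions of the vortex ODE system. Then the degree-one vortex U₀ = (u₀, A₀) solves the Ginzburg–Landau system with ε = 1 on ℝ² ∖ {0}; explicitly, for every z ∈ ℝ² ∖ {0}: −Σ_{j=1,2} ∂ⱼ^{A₀}(∂ⱼ^{A₀}u₀)(z) = ½(1−|u₀(z)|²)u₀(z), and for k = 1,2: −Σ_{j=1,2} ∂ⱼ(∂ⱼ(A₀)ₖ − ∂ₖ(A₀)ⱼ)(z) = ⟨∂ₖ^{A₀}u₀(z), i u₀(z)⟩. -/

import Mathlib

/-!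
STATEMENT 0: the degree-one vortex `U₀ = (u₀, A₀)` built from solutions `f, a` of the
vortex ODE system solves the Ginzburg–Landau system with `ε = 1` on `ℝ² \ {0}`.
-/

open Complex

noncomputable section

/-- Partial derivative in the `j`-th coordinate direction. -/
def pd {n : ℕ} {E : Type*} [NormedAddCommGroup E] [NormedSpace ℝ E]
    (j : Fin n) (f : (Fin n → ℝ) → E) (x : Fin n → ℝ) : E :=
  fderiv ℝ f x (Pi.single j 1)

/-- Covariant partial derivative `∂ⱼ^A u = ∂ⱼu − iAⱼu`. -/
def covD {n : ℕ} (j : Fin n) (A : (Fin n → ℝ) → Fin n → ℝ)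
    (u : (Fin n → ℝ) → ℂ) (x : Fin n → ℝ) : ℂ :=
  pd j u x - Complex.I * (A x j : ℂ) * u x

/-- Real pairing `⟨v,w⟩ = Re (v * conj w)`. -/
def rpair (v w : ℂ) : ℝ := (v * (starRingEnd ℂ) w).re

/-- Euclidean radius in `ℝ²`. -/
def rad (z : Fin 2 → ℝ) : ℝ := Real.sqrt ((z 0) ^ 2 + (z 1) ^ 2)

/-- The degree-one vortex profile `u₀(z) = f(|z|) z/|z|`, identifying `ℝ² ≅ ℂ`. -/
def vortexU (f : ℝ → ℝ) (z : Fin 2 → ℝ) : ℂ :=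
  ((f (rad z) / rad z : ℝ) : ℂ) * ((z 0 : ℂ) + (z 1 : ℂ) * Complex.I)

/-- The degree-one vortex potential `A₀(z) = a(|z|)|z|⁻²(−z₂, z₁)`. -/
def vortexA (a : ℝ → ℝ) (z : Fin 2 → ℝ) : Fin 2 → ℝ :=
  fun j => a (rad z) / (rad z) ^ 2 * (if j = 0 then -(z 1) else z 0)

/-- `F` is differentiable at `x` with `j`-th partial derivative `v`. -/
def HPD {n : ℕ} {E : Type*} [NormedAddCommGroup E] [NormedSpace ℝ E]
    (j : Fin n) (F : (Fin n → ℝ) → E) (x : Fin n → ℝ) (v : E) : Prop :=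
  DifferentiableAt ℝ F x ∧ pd j F x = v

section HPDrules

variable {n : ℕ} {j : Fin n} {x : Fin n → ℝ}

theorem HPD.add {E : Type*} [NormedAddCommGroup E] [NormedSpace ℝ E]
    {F G : (Fin n → ℝ) → E} {v w : E} (hF : HPD j F x v) (hG : HPD j G x w) :
    HPD j (fun y => F y + G y) x (v + w) := by
  refine ⟨hF.1.add hG.1, ?_⟩
  rw [← hF.2, ← hG.2]
  unfold pd
  rw [(hF.1.hasFDerivAt.fun_add hG.1.hasFDerivAt).fderiv]
  rfl

theorem HPD.mul {E : Type*} [NormedCommRing E] [NormedAlgebra ℝ E]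
    {F G : (Fin n → ℝ) → E} {v w : E} (hF : HPD j F x v) (hG : HPD j G x w) :
    HPD j (fun y => F y * G y) x (v * G x + F x * w) := by
  refine ⟨hF.1.mul hG.1, ?_⟩
  rw [← hF.2, ← hG.2]
  unfold pd
  rw [(hF.1.hasFDerivAt.fun_mul hG.1.hasFDerivAt).fderiv]
  simp
  ring

theorem HPD.const {E : Type*} [NormedAddCommGroup E] [NormedSpace ℝ E] (c : E) :
    HPD j (fun _ => c) x 0 := by
  refine ⟨differentiableAt_const c, ?_⟩
  simp [pd]

theorem HPD.coord (k : Fin n) :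
    HPD j (fun y => y k) x (if k = j then 1 else 0) := by
  refine ⟨differentiableAt_apply k x, ?_⟩
  unfold pd
  rw [(hasFDerivAt_apply k x).fderiv]
  simp [Pi.single_apply]

theorem HPD.ofReal {F : (Fin n → ℝ) → ℝ} {v : ℝ} (hF : HPD j F x v) :
    HPD j (fun y => (F y : ℂ)) x (v : ℂ) := by
  have h := Complex.ofRealCLM.hasFDerivAt.comp x hF.1.hasFDerivAt
  have h2 : HasFDerivAt (fun y => (F y : ℂ)) (Complex.ofRealCLM.comp (fderiv ℝ F x)) x := h
  refine ⟨h2.differentiableAt, ?_⟩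
  rw [← hF.2]
  unfold pd
  rw [h2.fderiv]
  rfl

theorem HPD.comp {F : (Fin n → ℝ) → ℝ} {v : ℝ} (hF : HPD j F x v) {G : ℝ → ℝ} {d : ℝ}
    (hG : HasDerivAt G d (F x)) :
    HPD j (fun y => G (F y)) x (d * v) := by
  have h : HasFDerivAt (fun y => G (F y)) (d • fderiv ℝ F x) x :=
    hG.comp_hasFDerivAt x hF.1.hasFDerivAt
  refine ⟨h.differentiableAt, ?_⟩
  rw [← hF.2]
  unfold pd
  rw [h.fderiv]
  rfl

theorem HPD.val {E : Type*} [NormedAddCommGroup E] [NormedSpace ℝ E]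
    {F : (Fin n → ℝ) → E} {v w : E} (hF : HPD j F x v) (h : v = w) : HPD j F x w := h ▸ hF

theorem pd_congr {E : Type*} [NormedAddCommGroup E] [NormedSpace ℝ E]
    {F G : (Fin n → ℝ) → E} (hx : x ≠ 0) (h : ∀ y, y ≠ 0 → F y = G y) : pd j F x = pd j G x := by
  unfold pd
  rw [Filter.EventuallyEq.fderiv_eq]
  filter_upwards [isOpen_ne.mem_nhds hx] with y hy using h y hy

end HPDrules

theorem rad_sq (z : Fin 2 → ℝ) : rad z ^ 2 = z 0 ^ 2 + z 1 ^ 2 :=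
  Real.sq_sqrt (by positivity)

theorem sq_pos_of_ne {z : Fin 2 → ℝ} (hz : z ≠ 0) : 0 < z 0 ^ 2 + z 1 ^ 2 := by
  by_contra h
  apply hz
  have h0 : z 0 = 0 := by nlinarith [sq_nonneg (z 0), sq_nonneg (z 1)]
  have h1 : z 1 = 0 := by nlinarith [sq_nonneg (z 0), sq_nonneg (z 1)]
  ext i
  fin_cases i <;> simp [h0, h1]

theorem rad_pos {z : Fin 2 → ℝ} (hz : z ≠ 0) : 0 < rad z := Real.sqrt_pos.2 (sq_pos_of_ne hz)

theorem HPD_rad (j : Fin 2) {z : Fin 2 → ℝ} (hz : z ≠ 0) : HPD j rad z (z j / rad z) := by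
  have h := (((HPD.coord (j := j) (x := z) 0).mul (HPD.coord 0)).add
    ((HPD.coord (j := j) (x := z) 1).mul (HPD.coord 1)))
  have hp : z 0 * z 0 + z 1 * z 1 ≠ 0 := by have := sq_pos_of_ne hz; nlinarith
  have h2 := h.comp (Real.hasDerivAt_sqrt hp)
  have e : rad = fun y => Real.sqrt (y 0 * y 0 + y 1 * y 1) := by
    funext y; simp [rad, sq]
  rw [e]
  refine h2.val ?_
  have : Real.sqrt (z 0 * z 0 + z 1 * z 1) ≠ 0 := (Real.sqrt_ne_zero'.2 (lt_of_le_of_ne (by nlinarith [sq_nonneg (z 0), sq_nonneg (z 1)]) hp.symm))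
  fin_cases j <;> simp <;> field_simp <;> ring

theorem HPD_radial (j : Fin 2) {z : Fin 2 → ℝ} (hz : z ≠ 0) {G : ℝ → ℝ} {d : ℝ}
    (hG : HasDerivAt G d (rad z)) :
    HPD j (fun y => G (rad y)) z (d * (z j / rad z)) := (HPD_rad j hz).comp hG

theorem HPD_zeta (j : Fin 2) (z : Fin 2 → ℝ) :
    HPD j (fun y : Fin 2 → ℝ => (y 0 : ℂ) + (y 1 : ℂ) * Complex.I) z
      (if j = 0 then 1 else Complex.I) := by
  refine ((HPD.coord (j := j) (x := z) 0).ofReal.add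
    ((HPD.coord (j := j) (x := z) 1).ofReal.mul (HPD.const Complex.I))).val ?_
  fin_cases j <;> simp

theorem HPD_p (k j : Fin 2) (z : Fin 2 → ℝ) :
    HPD j (fun y : Fin 2 → ℝ => if k = 0 then -(y 1) else y 0) z
      (if k = j then 0 else if k = 0 then -1 else 1) := by
  have h0 := HPD.coord (j := j) (x := z) 0
  have h1 := (HPD.const (j := j) (x := z) (-1 : ℝ)).mul (HPD.coord (j := j) (x := z) 1)
  have e : (fun y : Fin 2 → ℝ => -1 * y 1) = fun y => -(y 1) := by funext y; ring
  rw [e] at h1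
  fin_cases k <;> fin_cases j <;> simp at h0 h1 ⊢ <;> assumption

theorem covD_one (f a f' : ℝ → ℝ) (hf : ∀ r, 0 < r → HasDerivAt f (f' r) r)
    (j : Fin 2) {z : Fin 2 → ℝ} (hz : z ≠ 0) :
    covD j (vortexA a) (vortexU f) z =
      (((f' (rad z) * rad z - f (rad z)) / rad z ^ 3 : ℝ) : ℂ) *
          ((z j : ℂ) * ((z 0 : ℂ) + (z 1 : ℂ) * Complex.I))
        + (((f (rad z) / rad z : ℝ) : ℂ) * (if j = 0 then 1 else Complex.I)
        + -Complex.I * (((a (rad z) / rad z ^ 2 * (f (rad z) / rad z) : ℝ) : ℂ) *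
          (((if j = 0 then -(z 1) else z 0 : ℝ) : ℂ) *
            ((z 0 : ℂ) + (z 1 : ℂ) * Complex.I)))) := by
  have hr := rad_pos hz
  have hg := (hf _ hr).div (hasDerivAt_id _) hr.ne'
  have h := (HPD_radial j hz hg).ofReal.mul (HPD_zeta j z)
  have hu : pd j (vortexU f) z = _ := h.2
  unfold covD
  rw [hu]
  simp only [vortexU, vortexA, Pi.div_apply, id]
  have hc : (rad z : ℂ) ≠ 0 := by exact_mod_cast hr.ne'
  push_cast
  field_simp
  ring

theorem pd_covD_one (f a f' : ℝ → ℝ) (hf : ∀ r, 0 < r → HasDerivAt f (f' r) r)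
    (j : Fin 2) {z : Fin 2 → ℝ} (hz : z ≠ 0) {h' k' g' : ℝ}
    (hh : HasDerivAt (fun r => (f' r * r - f r) / r ^ 3) h' (rad z))
    (hg : HasDerivAt (fun r => f r / r) g' (rad z))
    (hk : HasDerivAt (fun r => a r / r ^ 2 * (f r / r)) k' (rad z)) :
    pd j (covD j (vortexA a) (vortexU f)) z = 
      ((h' * (z j / rad z) : ℝ) : ℂ) * ((z j : ℂ) * ((z 0 : ℂ) + (z 1 : ℂ) * Complex.I))
      + (((f' (rad z) * rad z - f (rad z)) / rad z ^ 3 : ℝ) : ℂ) *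
          ((z 0 : ℂ) + (z 1 : ℂ) * Complex.I + (z j : ℂ) * (if j = 0 then 1 else Complex.I))
      + ((g' * (z j / rad z) : ℝ) : ℂ) * (if j = 0 then 1 else Complex.I)
      - Complex.I * ((k' * (z j / rad z) : ℝ) : ℂ) * (((if j = 0 then -(z 1) else z 0 : ℝ) : ℂ) *
            ((z 0 : ℂ) + (z 1 : ℂ) * Complex.I))
      - Complex.I * ((a (rad z) / rad z ^ 2 * (f (rad z) / rad z) : ℝ) : ℂ) *
          (((if j = 0 then -(z 1) else z 0 : ℝ) : ℂ) * (if j = 0 then 1 else Complex.I)) := by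
  rw [pd_congr hz (fun y hy => covD_one f a f' hf j hy)]
  have h := ((HPD_radial j hz hh).ofReal.mul ((HPD.coord j).ofReal.mul (HPD_zeta j z))).add
    (((HPD_radial j hz hg).ofReal.mul (HPD.const (if j = 0 then 1 else Complex.I))).add
      ((HPD.const (-Complex.I)).mul ((HPD_radial j hz hk).ofReal.mul
        ((HPD_p j j z).ofReal.mul (HPD_zeta j z)))))
  refine h.2.trans ?_
  simp only [if_true, Complex.ofReal_one, Complex.ofReal_zero]
  ring

theorem curl_eq (a a' : ℝ → ℝ) (ha : ∀ r, 0 < r → HasDerivAt a (a' r) r)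
    {z : Fin 2 → ℝ} (hz : z ≠ 0) :
    pd 0 (fun w => vortexA a w 1) z - pd 1 (fun w => vortexA a w 0) z = a' (rad z) / rad z := by
  have hr := rad_pos hz
  have hb := (ha _ hr).div ((hasDerivAt_id _).pow 2) (pow_ne_zero 2 hr.ne')
  have h1 : pd 0 (fun w => vortexA a w 1) z = _ := ((HPD_radial 0 hz hb).mul (HPD_p 1 0 z)).2
  have h0 : pd 1 (fun w => vortexA a w 0) z = _ := ((HPD_radial 1 hz hb).mul (HPD_p 0 1 z)).2
  rw [h1, h0]
  have hs := rad_sq z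
  simp
  field_simp
  linear_combination (2 * a (rad z) - rad z * a' (rad z)) * hs

theorem statement0 (f a : ℝ → ℝ)
    (hf : ContDiffOn ℝ 2 f (Set.Ioi 0)) (ha : ContDiffOn ℝ 2 a (Set.Ioi 0))
    (hodef : ∀ r ∈ Set.Ioi (0 : ℝ),
      -(deriv (deriv f) r) - deriv f r / r + (1 - a r) ^ 2 * f r / r ^ 2
        - (1 / 2) * f r * (1 - (f r) ^ 2) = 0)
    (hodea : ∀ r ∈ Set.Ioi (0 : ℝ),
      -(deriv (deriv a) r) + deriv a r / r - (f r) ^ 2 * (1 - a r) = 0) :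
    ∀ z : Fin 2 → ℝ, z ≠ 0 →
      (-∑ j : Fin 2, covD j (vortexA a) (covD j (vortexA a) (vortexU f)) z
          = (1 / 2 : ℂ) * ((1 - Complex.normSq (vortexU f z) : ℝ) : ℂ) * vortexU f z) ∧
      (∀ k : Fin 2,
        -∑ j : Fin 2, pd j
            (fun y => pd j (fun w => vortexA a w k) y - pd k (fun w => vortexA a w j) y) z
          = rpair (covD k (vortexA a) (vortexU f) z) (Complex.I * vortexU f z)) := by
  have df : ∀ r, 0 < r → HasDerivAt f (deriv f r) r := fun r hr =>
    ((hf.contDiffAt (Ioi_mem_nhds hr)).differentiableAt (by norm_num)).hasDerivAt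
  have da : ∀ r, 0 < r → HasDerivAt a (deriv a r) r := fun r hr =>
    ((ha.contDiffAt (Ioi_mem_nhds hr)).differentiableAt (by norm_num)).hasDerivAt
  have d2 : ∀ g : ℝ → ℝ, ContDiffOn ℝ 2 g (Set.Ioi 0) → ∀ r, 0 < r →
      HasDerivAt (deriv g) (deriv (deriv g) r) r := fun g hg r hr => by
    have h : ContDiffOn ℝ 1 (deriv g) (Set.Ioi 0) :=
      hg.deriv_of_isOpen isOpen_Ioi (by norm_num)
    exact ((h.contDiffAt (Ioi_mem_nhds hr)).differentiableAt (by norm_num)).hasDerivAt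
  have ddf := d2 f hf
  have dda := d2 a ha
  intro z hz
  have hr := rad_pos hz
  have hs := rad_sq z
  have of := hodef _ hr
  have oa := hodea _ hr
  constructor
  · have hg : HasDerivAt (fun r => f r / r)
        ((deriv f (rad z) * rad z - f (rad z)) / rad z ^ 3 * rad z) (rad z) := by
      refine ((df _ hr).div (hasDerivAt_id _) hr.ne').congr_deriv ?_
      simp
      field_simp
    have hb := (da _ hr).div ((hasDerivAt_id _).pow 2) (pow_ne_zero 2 hr.ne')
    have hk := hb.mul hg
    obtain ⟨H', hH'⟩ : ∃ H', H' = deriv (deriv f) (rad z) / rad z ^ 2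
      - 3 * deriv f (rad z) / rad z ^ 3 + 3 * f (rad z) / rad z ^ 4 := ⟨_, rfl⟩
    have hh : HasDerivAt (fun r => (deriv f r * r - f r) / r ^ 3) H' (rad z) := by
      refine ((((ddf _ hr).mul (hasDerivAt_id _)).sub (df _ hr)).div
        ((hasDerivAt_id _).pow 3) (pow_ne_zero 3 hr.ne')).congr_deriv ?_
      rw [hH']
      simp
      field_simp
      ring
    have rid : H' * rad z + 4 * ((deriv f (rad z) * rad z - f (rad z)) / rad z ^ 3)
        + 2 * (a (rad z) / rad z ^ 2) * (f (rad z) / rad z)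
        - (a (rad z) / rad z ^ 2) ^ 2 * (f (rad z) / rad z) * rad z ^ 2
        = -(1 / 2) * (1 - f (rad z) ^ 2) * (f (rad z) / rad z) := by
      have of' : deriv (deriv f) (rad z) = - deriv f (rad z) / rad z
        + (1 - a (rad z)) ^ 2 * f (rad z) / rad z ^ 2
        - (1 / 2) * f (rad z) * (1 - (f (rad z)) ^ 2) := by linear_combination -of
      rw [hH', of']
      field_simp
      ring
    have key := fun j => pd_covD_one f a (deriv f) df j hz hh hg hk
    have e1 : ∀ j, covD j (vortexA a) (covD j (vortexA a) (vortexU f)) z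
      = pd j (covD j (vortexA a) (vortexU f)) z
        - Complex.I * (vortexA a z j : ℂ) * covD j (vortexA a) (vortexU f) z := fun j => rfl
    have hn : Complex.normSq (vortexU f z) = f (rad z) ^ 2 := by
      have : Complex.normSq ((z 0 : ℂ) + (z 1 : ℂ) * Complex.I) = rad z ^ 2 := by
        rw [Complex.normSq_add_mul_I, hs]
      rw [vortexU, Complex.normSq_mul, this, Complex.normSq_ofReal]
      field_simp
    rw [Fin.sum_univ_two, e1, e1, key, key, hn, covD_one f a _ df 0 hz, covD_one f a _ df 1 hz]
    simp only [vortexU, vortexA]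
    clear key e1 hn hh hH' hk hb hg
    generalize hGd : f (rad z) / rad z = G at *
    generalize (deriv f (rad z) * rad z - f (rad z)) / rad z ^ 3 = H at *
    generalize a (rad z) / rad z ^ 2 = B at *
    obtain ⟨Q, rfl⟩ : ∃ Q, H' = Q * rad z := ⟨H' / rad z, by field_simp⟩
    have q : ∀ s t : ℝ, s * rad z * (t / rad z) = s * t := fun s t => by field_simp
    simp only [q]
    generalize f (rad z) = F at *
    apply Complex.ext
    · simp [-Complex.ofReal_div, -Complex.ofReal_pow]
      linear_combination (-z 0) * rid + z 0 * (Q - B ^ 2 * G) * hs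
    · simp [-Complex.ofReal_div, -Complex.ofReal_pow]
      linear_combination (-z 1) * rid + z 1 * (Q - B ^ 2 * G) * hs
  · have pc : ∀ j, pd j (fun y => pd 0 (fun w => vortexA a w 1) y
        - pd 1 (fun w => vortexA a w 0) y) z = _ := fun j =>
      (pd_congr hz (fun y hy => curl_eq a (deriv a) da hy)).trans
        (HPD_radial j hz ((dda _ hr).div (hasDerivAt_id _) hr.ne')).2
    have pc' : ∀ j, pd j (fun y => pd 1 (fun w => vortexA a w 0) y
        - pd 0 (fun w => vortexA a w 1) y) z = _ := fun j =>
      (pd_congr hz (fun y hy => by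
          rw [← neg_sub, curl_eq a (deriv a) da hy, neg_eq_neg_one_mul]; rfl)).trans
        ((HPD.const (-1 : ℝ)).mul
          (HPD_radial j hz ((dda _ hr).div (hasDerivAt_id _) hr.ne'))).2
    have pz : ∀ j, pd j (fun _ : Fin 2 → ℝ => (0 : ℝ)) z = 0 := fun j => (HPD.const 0).2
    have oa' : deriv (deriv a) (rad z) = deriv a (rad z) / rad z
      - (f (rad z)) ^ 2 * (1 - a (rad z)) := by linear_combination -oa
    intro k
    rw [covD_one f a _ df k hz, Fin.sum_univ_two]
    have hx : z 1 ^ 2 = rad z ^ 2 - z 0 ^ 2 := by linear_combination -hs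
    simp only [rpair, vortexU]
    clear hz
    generalize rad z = r at *
    generalize (deriv f r * r - f r) / r ^ 3 = H at *
    fin_cases k
    · simp [pc', pz, oa', -Complex.ofReal_div, -Complex.ofReal_pow]
      field_simp
      linear_combination (f r ^ 2 * a r * z 1) * hs
    · simp [pc, pz, oa', -Complex.ofReal_div, -Complex.ofReal_pow]
      field_simp
      linear_combination (-f r ^ 2 * a r * z 0) * hs

end
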